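/- If X is a proper geodesic metric space and A ⊆ X is a nonempty closed subset, then the pseudometric space D_∞(X,A) of ∞-persistence diagrams with the bottleneck distance is geodesic. -/

import Mathlib

open scoped ENNReal
open Filter Metric Set

/-- The bottleneck (pre)distance between two `ℕ`-indexed representatives of persistence
diagrams on the metric pair `(X, A)`: the infimum, over countable multisets `α`, `β` of points
of `A` adjoined to `f` and `g` respectively and over bijections between the resulting
multisets, of the supremum displacement. -/
noncomputable def bdist {X : Type*} [MetricSpace X] (A : Set X) (f g : ℕ → X) : ℝ≥0∞ :=
  ⨅ (α : ℕ → X) (_ : ∀ n, α n ∈ A) (β : ℕ → X) (_ : ∀ n, β n ∈ A)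
    (e : (ℕ ⊕ ℕ) ≃ (ℕ ⊕ ℕ)), ⨆ n : ℕ ⊕ ℕ, edist (Sum.elim f α n) (Sum.elim g β (e n))

/-- Two representatives define the same persistence diagram on `(X, A)` iff their restrictions
away from `A` agree as multisets, i.e. there is a value-preserving bijection between the index
sets of points outside `A`. -/
def DiagEquiv {X : Type*} [MetricSpace X] (A : Set X) (f g : ℕ → X) : Prop :=
  ∃ e : {n : ℕ // f n ∉ A} ≃ {n : ℕ // g n ∉ A}, ∀ p, g (e p).1 = f p.1

/-- A representative belongs to `D_∞(X, A)` iff it is at finite bottleneck distance from the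
empty diagram (represented by any multiset of points of `A`). -/
def IsDiagram {X : Type*} [MetricSpace X] (A : Set X) (f : ℕ → X) : Prop :=
  ∃ g : ℕ → X, (∀ n, g n ∈ A) ∧ bdist A f g ≠ ⊤

/-- The quotient metric of `X/A`, read on representatives in `X`:
`d_{X/A}(x,y) = min (d(x,y)) (d(x,A) + d(y,A))`. -/
noncomputable def qdist {X : Type*} [MetricSpace X] (A : Set X) (x y : X) : ℝ :=
  min (dist x y) (Metric.infDist x A + Metric.infDist y A)

/-- An `ε`-matching of the diagrams `f` and `g` on `(X, A)`: a partial bijection `R` between the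
index sets that moves matched points by at most `ε`, all unmatched points being `ε`-close
to `A`. -/
structure IsMatching {X ι κ : Type*} [MetricSpace X] (A : Set X) (ε : ℝ≥0∞) (f : ι → X)
    (g : κ → X) (R : ι → κ → Prop) : Prop where
  right_unique : ∀ i j j', R i j → R i j' → j = j'
  left_unique : ∀ i i' j, R i j → R i' j → i = i'
  edist_le : ∀ i j, R i j → edist (f i) (g j) ≤ ε
  left : ∀ i, (∀ j, ¬ R i j) → ∃ a ∈ A, edist (f i) a ≤ ε
  right : ∀ j, (∀ i, ¬ R i j) → ∃ a ∈ A, edist (g j) a ≤ ε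

/-- Two diagrams are `ε`-near if they admit an `ε`-matching. -/
def Near {X ι κ : Type*} [MetricSpace X] (A : Set X) (ε : ℝ≥0∞) (f : ι → X) (g : κ → X) : Prop :=
  ∃ R : ι → κ → Prop, IsMatching A ε f g R

section Matching

variable {X ι κ l : Type*} [MetricSpace X] {A : Set X} {ε δ : ℝ≥0∞}
  {f : ι → X} {g : κ → X} {h : l → X}

theorem IsMatching.flip {R : ι → κ → Prop} (hR : IsMatching A ε f g R) :
    IsMatching A ε g f (fun j i => R i j) where
  right_unique _ _ _ := hR.left_unique _ _ _
  left_unique _ _ _ := hR.right_unique _ _ _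
  edist_le _ _ hij := by rw [edist_comm]; exact hR.edist_le _ _ hij
  left := hR.right
  right := hR.left

theorem Near.symm (hfg : Near A ε f g) : Near A ε g f :=
  let ⟨_, hR⟩ := hfg
  ⟨_, hR.flip⟩

theorem exists_mem_edist_le_of_comp {R : ι → κ → Prop} {S : κ → l → Prop}
    (hR : IsMatching A ε f g R) (hS : IsMatching A δ g h S) (i : ι)
    (hi : ∀ k, ¬ ∃ j, R i j ∧ S j k) : ∃ a ∈ A, edist (f i) a ≤ ε + δ := by
  by_cases hij : ∃ j, R i j
  · obtain ⟨j, hij⟩ := hij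
    obtain ⟨a, ha, hja⟩ := hS.left j fun k hk => hi k ⟨j, hij, hk⟩
    exact ⟨a, ha, (edist_triangle _ (g j) _).trans (add_le_add (hR.edist_le _ _ hij) hja)⟩
  · obtain ⟨a, ha, hia⟩ := hR.left i fun j hj => hij ⟨j, hj⟩
    exact ⟨a, ha, hia.trans le_self_add⟩

theorem Near.trans (hfg : Near A ε f g) (hgh : Near A δ g h) : Near A (ε + δ) f h := by
  obtain ⟨R, hR⟩ := hfg
  obtain ⟨S, hS⟩ := hgh
  refine ⟨fun i k => ∃ j, R i j ∧ S j k, ?_, ?_, ?_, ?_, ?_⟩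
  · rintro i k k' ⟨j, hij, hjk⟩ ⟨j', hij', hjk'⟩
    obtain rfl := hR.right_unique _ _ _ hij hij'
    exact hS.right_unique _ _ _ hjk hjk'
  · rintro i i' k ⟨j, hij, hjk⟩ ⟨j', hij', hjk'⟩
    obtain rfl := hS.left_unique _ _ _ hjk hjk'
    exact hR.left_unique _ _ _ hij hij'
  · rintro i k ⟨j, hij, hjk⟩
    exact (edist_triangle _ (g j) _).trans
      (add_le_add (hR.edist_le _ _ hij) (hS.edist_le _ _ hjk))
  · exact exists_mem_edist_le_of_comp hR hS
  · intro k hk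
    rw [add_comm]
    exact exists_mem_edist_le_of_comp hS.flip hR.flip k
      fun i ⟨j, hjk, hij⟩ => hk i ⟨j, hij, hjk⟩

theorem near_of_equiv (e : ι ≃ κ) (he : ∀ i, edist (f i) (g (e i)) ≤ ε) : Near A ε f g := by
  refine ⟨fun i j => e i = j, ?_, ?_, ?_, ?_, ?_⟩
  · rintro i j j' rfl rfl
    rfl
  · rintro i i' j rfl hi
    exact (e.injective hi).symm
  · rintro i j rfl
    exact he i
  · exact fun i hi => absurd rfl (hi (e i))
  · exact fun j hj => absurd (e.apply_symm_apply j) (hj (e.symm j))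

theorem near_of_forall_mem (hf : ∀ i, f i ∈ A) (hg : ∀ j, g j ∈ A) : Near A 0 f g :=
  ⟨fun _ _ => False, nofun, nofun, nofun, fun i _ => ⟨f i, hf i, by simp⟩,
    fun j _ => ⟨g j, hg j, by simp⟩⟩

end Matching

section Bottleneck

variable {X : Type*} [MetricSpace X] {A : Set X} {ε : ℝ≥0∞} {f g h : ℕ → X}

theorem near_of_bdist_lt (hfg : bdist A f g < ε) : Near A ε f g := by
  simp only [bdist, iInf_lt_iff] at hfg
  obtain ⟨α, hα, β, hβ, e, he⟩ := hfg
  have he' : ∀ n, edist (Sum.elim f α n) (Sum.elim g β (e n)) ≤ ε := fun n =>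
    (le_iSup (fun n => edist (Sum.elim f α n) (Sum.elim g β (e n))) n).trans he.le
  refine ⟨fun i j => e (.inl i) = .inl j, ?_, ?_, ?_, ?_, ?_⟩
  · intro i j j' hj hj'
    exact Sum.inl_injective (hj.symm.trans hj')
  · intro i i' j hj hj'
    exact Sum.inl_injective (e.injective (hj.trans hj'.symm))
  · intro i j hij
    simpa [hij] using he' (.inl i)
  · intro i hi
    have hdist := he' (.inl i)
    rcases hei : e (.inl i) with j | j
    · exact absurd hei (hi j)
    · exact ⟨β j, hβ j, by simpa [hei] using hdist⟩
  · intro j hj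
    have hdist := he' (e.symm (.inl j))
    rcases hei : e.symm (.inl j) with i | i
    · exact absurd ((e.symm_apply_eq.1 hei).symm) (hj i)
    · exact ⟨α i, hα i, by
        rw [hei, ← hei, e.apply_symm_apply, hei, edist_comm] at hdist; simpa using hdist⟩

open Classical in
/-- The map underlying the bijection that extends a partial bijection `R`. -/
noncomputable def matchMap {ι κ : Type*} (R : ι → κ → Prop) : ι ⊕ κ → κ ⊕ ι
  | .inl i => if hi : ∃ j, R i j then .inl hi.choose else .inr i
  | .inr j => if hj : ∃ i, R i j then .inr hj.choose else .inl j

theorem matchMap_inl {ι κ : Type*} {R : ι → κ → Prop}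
    (hr : ∀ i j j', R i j → R i j' → j = j') {i : ι} {j : κ} (hij : R i j) :
    matchMap R (.inl i) = .inl j := by
  have hi : ∃ j, R i j := ⟨j, hij⟩
  simp [matchMap, hi, hr _ _ _ hi.choose_spec hij]

theorem matchMap_inr {ι κ : Type*} {R : ι → κ → Prop}
    (hl : ∀ i i' j, R i j → R i' j → i = i') {i : ι} {j : κ} (hij : R i j) :
    matchMap R (.inr j) = .inr i := by
  have hj : ∃ i, R i j := ⟨i, hij⟩
  simp [matchMap, hj, hl _ _ _ hj.choose_spec hij]

theorem matchMap_matchMap {ι κ : Type*} {R : ι → κ → Prop}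
    (hr : ∀ i j j', R i j → R i j' → j = j') (hl : ∀ i i' j, R i j → R i' j → i = i')
    (p : ι ⊕ κ) : matchMap (fun j i => R i j) (matchMap R p) = p := by
  rcases p with i | j
  · by_cases hi : ∃ j, R i j
    · obtain ⟨j, hij⟩ := hi
      rw [matchMap_inl hr hij]
      exact matchMap_inl (fun _ _ _ => hl _ _ _) hij
    · simp [matchMap, hi]
  · by_cases hj : ∃ i, R i j
    · obtain ⟨i, hij⟩ := hj
      rw [matchMap_inr hl hij]
      exact matchMap_inr (fun _ _ _ => hr _ _ _) hij
    · simp [matchMap, hj]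

theorem bdist_le_of_near (hA : A.Nonempty) (hfg : Near A ε f g) : bdist A f g ≤ ε := by
  obtain ⟨R, hR⟩ := hfg
  obtain ⟨a₀, ha₀⟩ := hA
  have hβ : ∀ i, ∃ a ∈ A, ((∀ j, ¬ R i j) → edist (f i) a ≤ ε) ∧ ((∃ j, R i j) → a = a₀) := by
    intro i
    by_cases hi : ∃ j, R i j
    · exact ⟨a₀, ha₀, fun h => absurd hi (by simpa using h), fun _ => rfl⟩
    · obtain ⟨a, ha, hia⟩ := hR.left i (by simpa using hi)
      exact ⟨a, ha, fun _ => hia, fun h => absurd h hi⟩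
  have hα : ∀ j, ∃ a ∈ A, ((∀ i, ¬ R i j) → edist (g j) a ≤ ε) ∧ ((∃ i, R i j) → a = a₀) := by
    intro j
    by_cases hj : ∃ i, R i j
    · exact ⟨a₀, ha₀, fun h => absurd hj (by simpa using h), fun _ => rfl⟩
    · obtain ⟨a, ha, hja⟩ := hR.right j (by simpa using hj)
      exact ⟨a, ha, fun _ => hja, fun h => absurd h hj⟩
  choose α hαA hα hα' using hα
  choose β hβA hβ hβ' using hβ
  let e : ℕ ⊕ ℕ ≃ ℕ ⊕ ℕ :=
    { toFun := matchMap R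
      invFun := matchMap fun j i => R i j
      left_inv := matchMap_matchMap hR.right_unique hR.left_unique
      right_inv := matchMap_matchMap (fun _ _ _ => hR.left_unique _ _ _)
        (fun _ _ _ => hR.right_unique _ _ _) }
  refine iInf_le_of_le α <| iInf_le_of_le hαA <| iInf_le_of_le β <| iInf_le_of_le hβA <|
    iInf_le_of_le e <| iSup_le ?_
  change ∀ n, edist (Sum.elim f α n) (Sum.elim g β (matchMap R n)) ≤ ε
  rintro (i | j)
  · by_cases hi : ∃ j, R i j
    · obtain ⟨j, hij⟩ := hi
      simpa [matchMap_inl hR.right_unique hij] using hR.edist_le _ _ hij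
    · simpa [matchMap, hi] using hβ i (by simpa using hi)
  · by_cases hj : ∃ i, R i j
    · obtain ⟨i, hij⟩ := hj
      simp [matchMap_inr hR.left_unique hij, hα' j ⟨i, hij⟩, hβ' i ⟨j, hij⟩]
    · simpa [matchMap, hj, edist_comm] using hα j (by simpa using hj)

theorem bdist_le_of_forall_near (hA : A.Nonempty) {r : ℝ≥0∞}
    (hfg : ∀ ε : ℝ≥0∞, 0 < ε → Near A (r + ε) f g) : bdist A f g ≤ r :=
  ENNReal.le_of_forall_pos_le_add fun ε hε _ =>
    bdist_le_of_near hA (hfg ε (by exact_mod_cast hε))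

theorem bdist_comm (hA : A.Nonempty) : bdist A f g = bdist A g f :=
  le_antisymm
    (le_of_forall_gt_imp_ge_of_dense fun _ hr => bdist_le_of_near hA (near_of_bdist_lt hr).symm)
    (le_of_forall_gt_imp_ge_of_dense fun _ hr => bdist_le_of_near hA (near_of_bdist_lt hr).symm)

theorem bdist_triangle (hA : A.Nonempty) : bdist A f h ≤ bdist A f g + bdist A g h := by
  rcases eq_or_ne (bdist A f g) ⊤ with hfg | hfg
  · simp [hfg]
  rcases eq_or_ne (bdist A g h) ⊤ with hgh | hgh
  · simp [hgh]
  refine bdist_le_of_forall_near hA fun ε hε => ?_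
  have h₁ : Near A (bdist A f g + ε / 2) f g :=
    near_of_bdist_lt (ENNReal.lt_add_right hfg (ENNReal.half_pos hε.ne').ne')
  have h₂ : Near A (bdist A g h + ε / 2) g h :=
    near_of_bdist_lt (ENNReal.lt_add_right hgh (ENNReal.half_pos hε.ne').ne')
  have := h₁.trans h₂
  rwa [add_add_add_comm, ENNReal.add_halves] at this

theorem bdist_ne_top_of_isDiagram (hA : A.Nonempty) (hf : IsDiagram A f) (hg : IsDiagram A g) :
    bdist A f g ≠ ⊤ := by
  obtain ⟨a, ha, hfa⟩ := hf
  obtain ⟨b, hb, hgb⟩ := hg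
  have hab : bdist A a b ≤ 0 := bdist_le_of_near hA (near_of_forall_mem ha hb)
  rw [bdist_comm hA] at hgb
  refine ne_top_of_le_ne_top (ENNReal.add_ne_top.2 ⟨hfa, ENNReal.add_ne_top.2
    ⟨ne_top_of_le_ne_top ENNReal.zero_ne_top hab, hgb⟩⟩)
    ((bdist_triangle (g := a) hA).trans (add_le_add le_rfl (bdist_triangle (g := b) hA)))

theorem IsDiagram.of_bdist_ne_top (hA : A.Nonempty) (hf : IsDiagram A f)
    (hgf : bdist A g f ≠ ⊤) : IsDiagram A g :=
  let ⟨a, ha, hfa⟩ := hf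
  ⟨a, ha, ne_top_of_le_ne_top (ENNReal.add_ne_top.2 ⟨hgf, hfa⟩) (bdist_triangle hA)⟩

end Bottleneck

theorem exists_injective_mem_of_infinite {ι : Type*} [Countable ι] (S : ι → Set ℕ)
    (hS : ∀ i, (S i).Infinite) : ∃ c : ι → ℕ, Function.Injective c ∧ ∀ i, c i ∈ S i := by
  rcases isEmpty_or_nonempty ι with hι | hι
  · exact ⟨isEmptyElim, fun i => isEmptyElim i, isEmptyElim⟩
  obtain ⟨u, hu⟩ := exists_injective_nat ι
  have hnext : ∀ k n : ℕ, ∃ m ∈ S (Function.invFun u k), n < m := fun k n => (hS _).exists_gt n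
  choose next hnext_mem hnext_lt using hnext
  let c : ℕ → ℕ := fun k => Nat.rec (next 0 0) (fun k prev => next (k + 1) prev) k
  have hc : StrictMono c := strictMono_nat_of_lt_succ fun k => hnext_lt (k + 1) (c k)
  have hc_mem : ∀ k, c k ∈ S (Function.invFun u k) := by
    rintro (_ | k)
    · exact hnext_mem 0 0
    · exact hnext_mem (k + 1) (c k)
  refine ⟨c ∘ u, hc.injective.comp hu, fun i => ?_⟩
  simpa [Function.leftInverse_invFun hu i] using hc_mem (u i)

/-- The point `x` is a limit of infinitely many members, counted with multiplicity, of `f`. -/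
def IsAccum {X : Type*} [MetricSpace X] (f : ℕ → X) (x : X) : Prop :=
  ∀ ε : ℝ≥0∞, 0 < ε → {n | edist (f n) x ≤ ε}.Infinite

/-- Adjoining countably many accumulation points and points of `A` to a diagram produces diagrams
at arbitrarily small matching distance: the new points are absorbed by shifting sequences of
members that are close to them. -/
theorem near_of_isAccum {X κ : Type*} [MetricSpace X] [Countable κ] {A : Set X} {f : ℕ → X}
    {h : κ → X} (u : ℕ → κ) (hu : Function.Injective u) (hfu : ∀ n, h (u n) = f n)
    (hacc : ∀ k, k ∉ range u → h k ∈ A ∨ IsAccum f (h k)) {ε : ℝ≥0∞} (hε : 0 < ε) :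
    Near A ε f h := by
  let M := {k : κ // k ∉ range u ∧ IsAccum f (h k)}
  obtain ⟨c, hc, hc_mem⟩ := exists_injective_mem_of_infinite
    (fun p : M × ℕ => {n | edist (f n) (h p.1.1) ≤ ε / 2})
    (fun p => p.1.2.2 _ (ENNReal.half_pos hε.ne'))
  simp only [mem_ofPred_eq] at hc_mem
  have hε2 : ε / 2 ≤ ε := ENNReal.half_le_self
  refine ⟨fun n k => (∃ m : M, n = c (m, 0) ∧ k = m) ∨
    (∃ (m : M) (i : ℕ), n = c (m, i + 1) ∧ k = u (c (m, i))) ∨ (n ∉ range c ∧ k = u n),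
    ?_, ?_, ?_, ?_, ?_⟩
  · rintro n k k' (⟨m, rfl, rfl⟩ | ⟨m, i, rfl, rfl⟩ | ⟨hn, rfl⟩)
      (⟨m', h', rfl⟩ | ⟨m', i', h', rfl⟩ | ⟨hn', rfl⟩)
    · have := hc h'
      simp_all
    · have := hc h'
      simp_all
    · exact absurd ⟨_, rfl⟩ hn'
    · have := hc h'
      simp_all
    · have := hc h'
      simp_all
    · exact absurd ⟨_, rfl⟩ hn'
    · exact absurd ⟨_, h'.symm⟩ hn
    · exact absurd ⟨_, h'.symm⟩ hn
    · rfl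
  · rintro n n' k (⟨m, rfl, rfl⟩ | ⟨m, i, rfl, rfl⟩ | ⟨hn, rfl⟩)
      (⟨m', rfl, h'⟩ | ⟨m', i', rfl, h'⟩ | ⟨hn', h'⟩)
    · rw [Subtype.ext h']
    · exact absurd ⟨_, h'.symm⟩ m.2.1
    · exact absurd ⟨_, h'.symm⟩ m.2.1
    · exact absurd ⟨_, h'⟩ m'.2.1
    · have := hc (hu h')
      simp_all
    · exact absurd ⟨_, hu h'⟩ hn'
    · exact absurd ⟨_, h'⟩ m'.2.1
    · exact absurd ⟨_, (hu h').symm⟩ hn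
    · exact hu h'
  · rintro n k (⟨m, rfl, rfl⟩ | ⟨m, i, rfl, rfl⟩ | ⟨hn, rfl⟩)
    · exact (hc_mem _).trans hε2
    · rw [hfu, ← ENNReal.add_halves ε]
      refine (edist_triangle_right _ _ (h m)).trans (add_le_add (hc_mem (m, i + 1)) (hc_mem (m, i)))
    · simp [hfu]
  · intro n hn
    by_cases hnc : n ∈ range c
    · obtain ⟨⟨m, _ | i⟩, rfl⟩ := hnc
      · exact absurd (.inl ⟨m, rfl, rfl⟩) (hn _)
      · exact absurd (.inr (.inl ⟨m, i, rfl, rfl⟩)) (hn _)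
    · exact absurd (.inr (.inr ⟨hnc, rfl⟩)) (hn _)
  · intro k hk
    by_cases hku : k ∈ range u
    · obtain ⟨n, rfl⟩ := hku
      by_cases hnc : n ∈ range c
      · obtain ⟨⟨m, i⟩, rfl⟩ := hnc
        exact absurd (.inr (.inl ⟨m, i, rfl, rfl⟩)) (hk _)
      · exact absurd (.inr (.inr ⟨hnc, rfl⟩)) (hk _)
    · rcases hacc k hku with hkA | hkacc
      · exact ⟨h k, hkA, by simp⟩
      · exact absurd (.inl ⟨⟨k, hku, hkacc⟩, rfl, rfl⟩) (hk _)

/-- Along an ultrafilter, the partners of a point under a sequence of matchings converge: either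
the partner is eventually constant, or the limit lies in `A` or is an accumulation point. -/
theorem exists_limit_partner {X : Type*} [MetricSpace X] [ProperSpace X] {A : Set X}
    (hAcl : IsClosed A) {f g : ℕ → X} {D : ℝ≥0∞} (hD : D ≠ ⊤) {ε : ℕ → ℝ≥0∞} (U : Ultrafilter ℕ)
    (hε : Tendsto ε U (nhds 0)) {R : ℕ → ℕ → ℕ → Prop}
    (hR : ∀ k, IsMatching A (D + ε k) f g (R k)) (n : ℕ) :
    ∃ y, edist (f n) y ≤ D ∧ (∀ m, (∀ᶠ k in U, R k n m) → y = g m) ∧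
      ((∀ m, ¬ ∀ᶠ k in U, R k n m) → y ∈ A ∨ IsAccum g y) := by
  have hlim : Tendsto (fun k => D + ε k) U (nhds D) := by
    simpa using hε.const_add D
  by_cases hstable : ∃ m, ∀ᶠ k in U, R k n m
  · obtain ⟨m, hm⟩ := hstable
    refine ⟨g m, ge_of_tendsto hlim (hm.mono fun k hk => (hR k).edist_le _ _ hk), ?_,
      fun h => absurd hm (h m)⟩
    intro m' hm'
    obtain ⟨k, hk, hk'⟩ := (hm.and hm').exists
    rw [(hR k).right_unique _ _ _ hk hk']
  simp only [not_exists] at hstable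
  have hp : ∀ k, ∃ p, edist (f n) p ≤ D + ε k ∧
      ((∃ m, R k n m ∧ p = g m) ∨ ((∀ m, ¬ R k n m) ∧ p ∈ A)) := by
    intro k
    by_cases h : ∃ m, R k n m
    · obtain ⟨m, hm⟩ := h
      exact ⟨g m, (hR k).edist_le _ _ hm, .inl ⟨m, hm, rfl⟩⟩
    · push Not at h
      obtain ⟨a, ha, hna⟩ := (hR k).left n h
      exact ⟨a, hna, .inr ⟨h, ha⟩⟩
  choose p hpdist hp using hp
  have hbdd : ∀ᶠ k in U, p k ∈ closedBall (f n) (D + 1).toReal := by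
    filter_upwards [hlim.eventually_lt_const (ENNReal.lt_add_right hD one_ne_zero)] with k hk
    rw [mem_closedBall, dist_comm, dist_edist]
    exact ENNReal.toReal_mono (by finiteness) ((hpdist k).trans hk.le)
  obtain ⟨y, -, hy⟩ := (isCompact_closedBall (f n) (D + 1).toReal).ultrafilter_le_nhds'
    (U.map p) hbdd
  have hy : Tendsto p U (nhds y) := hy
  refine ⟨y, le_of_tendsto_of_tendsto (tendsto_const_nhds.edist hy) hlim
    (.of_forall hpdist), fun m hm => absurd hm (hstable m), fun _ => ?_⟩
  by_cases hex : ∀ᶠ k in U, ∃ m, R k n m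
  · right
    intro δ hδ hfin
    have hclose : ∀ᶠ k in U, edist (p k) y ≤ δ := by
      filter_upwards [EMetric.tendsto_nhds.1 hy δ hδ] with k hk using hk.le
    have hmem : ∀ᶠ k in U, ∃ m ∈ {m | edist (g m) y ≤ δ}, R k n m := by
      filter_upwards [hclose, hex] with k hk ⟨m, hm⟩
      rcases hp k with ⟨m', hm', hpm⟩ | ⟨h, -⟩
      · exact ⟨m', by simpa [hpm] using hk, hm'⟩
      · exact absurd hm (h m)
    obtain ⟨m, -, hm⟩ := (Ultrafilter.eventually_exists_mem_iff hfin).1 hmem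
    exact hstable m hm
  · left
    refine hAcl.mem_of_tendsto hy ?_
    filter_upwards [Ultrafilter.eventually_not.2 hex] with k hk
    rcases hp k with ⟨m, hm, -⟩ | ⟨-, h⟩
    · exact absurd ⟨m, hm⟩ hk
    · exact h

open Classical in
/-- In a proper space the bottleneck distance is attained up to replacing the diagrams by
diagrams at distance zero from them. -/
theorem exists_optimal_pairing {X : Type*} [MetricSpace X] [ProperSpace X] {A : Set X}
    (hA : A.Nonempty) (hAcl : IsClosed A) {f g : ℕ → X} (hD : bdist A f g ≠ ⊤) :
    ∃ a b : ℕ ⊕ ℕ → X, (∀ p, edist (a p) (b p) ≤ bdist A f g) ∧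
      (∀ ε : ℝ≥0∞, 0 < ε → Near A ε f a) ∧ (∀ ε : ℝ≥0∞, 0 < ε → Near A ε g b) := by
  obtain ⟨a₀, ha₀⟩ := hA
  have hnear : ∀ k : ℕ, Near A (bdist A f g + (k : ℝ≥0∞)⁻¹) f g := fun k =>
    near_of_bdist_lt (ENNReal.lt_add_right hD (by simp))
  choose R hR using hnear
  let U := hyperfilter ℕ
  have hU : Tendsto (fun k : ℕ => (k : ℝ≥0∞)⁻¹) U (nhds 0) :=
    ENNReal.tendsto_inv_nat_nhds_zero.mono_left Nat.hyperfilter_le_atTop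
  choose y hy hy_stable hy_acc using exists_limit_partner hAcl hD U hU hR
  choose x hx hx_stable hx_acc using exists_limit_partner hAcl hD U hU fun k => (hR k).flip
  let St : ℕ → ℕ → Prop := fun n m => ∀ᶠ k in U, R k n m
  have hSt_left : ∀ n n' m, St n m → St n' m → n = n' := fun n n' m h h' =>
    let ⟨k, hk, hk'⟩ := (h.and h').exists
    (hR k).left_unique _ _ _ hk hk'
  have hSt_right : ∀ n m m', St n m → St n m' → m = m' := fun n m m' h h' =>
    let ⟨k, hk, hk'⟩ := (h.and h').exists
    (hR k).right_unique _ _ _ hk hk'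
  let a : ℕ ⊕ ℕ → X := Sum.elim f fun m => if ∃ n, St n m then a₀ else x m
  let b : ℕ ⊕ ℕ → X := Sum.elim y fun m => if ∃ n, St n m then a₀ else g m
  refine ⟨a, b, ?_, fun ε hε => ?_, fun ε hε => ?_⟩
  · rintro (n | m)
    · exact hy n
    · by_cases hm : ∃ n, St n m
      · simp [a, b, hm]
      · simpa [a, b, hm, edist_comm] using hx m
  · refine near_of_isAccum (f := f) (h := a) Sum.inl Sum.inl_injective (fun _ => rfl) ?_ hε
    rintro (n | m) hk
    · exact absurd ⟨n, rfl⟩ hk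
    · by_cases hm : ∃ n, St n m
      · simp [a, hm, ha₀]
      · simpa [a, hm] using hx_acc m fun n hn => hm ⟨n, hn⟩
  · let u : ℕ → ℕ ⊕ ℕ := fun m => if h : ∃ n, St n m then .inl h.choose else .inr m
    have hu_stable : ∀ n m, St n m → u m = .inl n := by
      intro n m hnm
      have h : ∃ n, St n m := ⟨n, hnm⟩
      simp only [u, dif_pos h, hSt_left _ _ _ h.choose_spec hnm]
    have hu_unstable : ∀ m, (¬ ∃ n, St n m) → u m = .inr m := fun m h => by
      simp only [u, dif_neg h]
    refine near_of_isAccum u ?_ ?_ ?_ hε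
    · intro m m' hmm
      by_cases h : ∃ n, St n m <;> by_cases h' : ∃ n, St n m'
      · obtain ⟨n, hn⟩ := h
        obtain ⟨n', hn'⟩ := h'
        rw [hu_stable _ _ hn, hu_stable _ _ hn'] at hmm
        obtain rfl := Sum.inl_injective hmm
        exact hSt_right _ _ _ hn hn'
      · obtain ⟨n, hn⟩ := h
        simp [hu_stable _ _ hn, hu_unstable _ h'] at hmm
      · obtain ⟨n', hn'⟩ := h'
        simp [hu_stable _ _ hn', hu_unstable _ h] at hmm
      · simpa [hu_unstable _ h, hu_unstable _ h'] using hmm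
    · intro m
      by_cases h : ∃ n, St n m
      · obtain ⟨n, hn⟩ := h
        rw [hu_stable _ _ hn]
        exact hy_stable n m hn
      · rw [hu_unstable _ h]
        simp [b, h]
    · rintro (n | m) hk
      · exact hy_acc n fun m hm => hk ⟨m, hu_stable _ _ hm⟩
      · by_cases h : ∃ n, St n m
        · simp [b, h, ha₀]
        · exact absurd ⟨m, hu_unstable _ h⟩ hk

theorem DiagEquiv.refl {X : Type*} [MetricSpace X] (A : Set X) (f : ℕ → X) : DiagEquiv A f f :=
  ⟨Equiv.refl _, fun _ => rfl⟩

/-- A path on the unit interval whose speed is at most the distance `D` of its endpoints moves at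
speed exactly `D`. -/
theorem bdist_eq_of_le {X : Type*} [MetricSpace X] {A : Set X} (hA : A.Nonempty)
    {Γ : ℝ → ℕ → X} (hD : bdist A (Γ 0) (Γ 1) ≠ ⊤)
    (hΓ : ∀ s t : ℝ, s ∈ Icc (0 : ℝ) 1 → t ∈ Icc (0 : ℝ) 1 →
      bdist A (Γ s) (Γ t) ≤ ENNReal.ofReal |s - t| * bdist A (Γ 0) (Γ 1)) (s t : ℝ)
    (hs : s ∈ Icc (0 : ℝ) 1) (ht : t ∈ Icc (0 : ℝ) 1) :
    bdist A (Γ s) (Γ t) = ENNReal.ofReal |s - t| * bdist A (Γ 0) (Γ 1) := by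
  wlog hst : s ≤ t generalizing s t
  · rw [bdist_comm hA, abs_sub_comm]
    exact this t s ht hs (le_of_not_ge hst)
  refine (hΓ s t hs ht).antisymm ?_
  set D := bdist A (Γ 0) (Γ 1) with hDdef
  have h0s : bdist A (Γ 0) (Γ s) ≤ ENNReal.ofReal s * D := by
    simpa [abs_of_nonneg hs.1] using hΓ 0 s (by simp) hs
  have ht1 : bdist A (Γ t) (Γ 1) ≤ ENNReal.ofReal (1 - t) * D := by
    simpa [abs_sub_comm t 1, abs_of_nonneg (sub_nonneg.2 ht.2)] using hΓ t 1 ht (by simp)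
  have htri : D ≤ ENNReal.ofReal s * D + (bdist A (Γ s) (Γ t) + ENNReal.ofReal (1 - t) * D) :=
    (bdist_triangle hA).trans (add_le_add h0s ((bdist_triangle hA).trans (add_le_add le_rfl ht1)))
  have hsplit : D = ENNReal.ofReal s * D +
      (ENNReal.ofReal (t - s) * D + ENNReal.ofReal (1 - t) * D) := by
    rw [← add_mul, ← add_mul, ← ENNReal.ofReal_add (by linarith) (by linarith [ht.2]),
      ← ENNReal.ofReal_add hs.1 (by linarith [ht.2])]
    simp
  rw [abs_sub_comm, abs_of_nonneg (sub_nonneg.2 hst)]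
  have hfin : ∀ r : ℝ, ENNReal.ofReal r * D ≠ ⊤ := fun r => ENNReal.mul_ne_top (by simp) hD
  have h := hsplit.symm.le.trans htri
  rwa [ENNReal.add_le_add_iff_left (hfin s), ENNReal.add_le_add_iff_right (hfin (1 - t))] at h

/-- If `X` is a proper geodesic metric space and `A ⊆ X` is nonempty and closed, then
`D_∞(X, A)` with the bottleneck distance is geodesic. -/
theorem stmt_18 {X : Type*} [MetricSpace X] [ProperSpace X]
    (hXgeo : ∀ x y : X, ∃ γ : ℝ → X, γ 0 = x ∧ γ 1 = y ∧
      ∀ s t : ℝ, s ∈ Set.Icc (0:ℝ) 1 → t ∈ Set.Icc (0:ℝ) 1 →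
        dist (γ s) (γ t) = |s - t| * dist x y)
    (A : Set X) (hA : A.Nonempty) (hAcl : IsClosed A) :
    ∀ f g : ℕ → X, IsDiagram A f → IsDiagram A g →
      ∃ Γ : ℝ → ℕ → X, DiagEquiv A (Γ 0) f ∧ DiagEquiv A (Γ 1) g ∧
        (∀ t ∈ Set.Icc (0:ℝ) 1, IsDiagram A (Γ t)) ∧
        ∀ s t : ℝ, s ∈ Set.Icc (0:ℝ) 1 → t ∈ Set.Icc (0:ℝ) 1 →
          bdist A (Γ s) (Γ t) = ENNReal.ofReal |s - t| * bdist A f g := by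
  intro f g hf hg
  have hD : bdist A f g ≠ ⊤ := bdist_ne_top_of_isDiagram hA hf hg
  obtain ⟨a, b, hab, hfa, hgb⟩ := exists_optimal_pairing hA hAcl hD
  choose γ hγ0 hγ1 hγ using hXgeo
  let q : ℕ ≃ ℕ ⊕ ℕ := Equiv.natSumNatEquivNat.symm
  let G : ℝ → ℕ ⊕ ℕ → X := fun t p => γ (a p) (b p) t
  let Γ : ℝ → ℕ → X := fun t => if t = 0 then f else if t = 1 then g else fun n => G t (q n)
  have hΓ0 : Γ 0 = f := by simp [Γ]
  have hΓ1 : Γ 1 = g := by simp [Γ]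
  have hΓG : ∀ t, ∀ ε : ℝ≥0∞, 0 < ε → Near A ε (Γ t) (G t) := by
    intro t ε hε
    by_cases h0 : t = 0
    · subst h0
      simpa [Γ, G, hγ0] using hfa ε hε
    by_cases h1 : t = 1
    · subst h1
      simpa [Γ, G, hγ1] using hgb ε hε
    · exact near_of_equiv q fun n => by simp [Γ, h0, h1]
  have hG : ∀ s t : ℝ, s ∈ Icc (0 : ℝ) 1 → t ∈ Icc (0 : ℝ) 1 →
      Near A (ENNReal.ofReal |s - t| * bdist A f g) (G s) (G t) := by
    intro s t hs ht
    refine near_of_equiv (Equiv.refl _) fun p => ?_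
    rw [Equiv.refl_apply, edist_dist, hγ _ _ s t hs ht, ENNReal.ofReal_mul (abs_nonneg _),
      ← edist_dist]
    gcongr
    exact hab p
  have hΓ : ∀ s t : ℝ, s ∈ Icc (0 : ℝ) 1 → t ∈ Icc (0 : ℝ) 1 →
      bdist A (Γ s) (Γ t) ≤ ENNReal.ofReal |s - t| * bdist A f g := by
    intro s t hs ht
    refine bdist_le_of_forall_near hA fun ε hε => ?_
    have hε' := ENNReal.half_pos hε.ne'
    have h := ((hΓG s _ hε').trans (hG s t hs ht)).trans (hΓG t _ hε').symm
    rwa [add_right_comm, ENNReal.add_halves, add_comm] at h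
  refine ⟨Γ, hΓ0 ▸ DiagEquiv.refl A f, hΓ1 ▸ DiagEquiv.refl A g, fun t ht => ?_, ?_⟩
  · refine hf.of_bdist_ne_top hA (ne_top_of_le_ne_top ?_ (hΓ0 ▸ hΓ t 0 ht (by simp)))
    exact ENNReal.mul_ne_top (by simp) hD
  · intro s t hs ht
    have h := bdist_eq_of_le hA (Γ := Γ) (by rwa [hΓ0, hΓ1]) (by rwa [hΓ0, hΓ1]) s t hs ht
    rwa [hΓ0, hΓ1] at h
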